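/- Fix an integer k ≥ 3. There exist constants C > 0 and A ≥ 0, depending only on k, such that for every integer N ≥ 2 and every finite sequence of complex numbers (a_n)_{n=-N}^{N}, one has ‖∑_{n=-N}^{N} a_n e(n x − n² x^k)‖_{L²(-1,1)} ≤ C (log N)^A N^{(k−2)/(6(k−1))} (∑_{n=-N}^{N} |a_n|²)^{1/2}. -/

import Mathlib

open MeasureTheory

/-- `e z = e^{2πiz}`. -/
noncomputable def e (t : ℝ) : ℂ := Complex.exp (2 * Real.pi * Complex.I * t)

open ComplexConjugate

lemma norm_e (t : ℝ) : ‖e t‖ = 1 := by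
  have : (2 * Real.pi * Complex.I * t : ℂ) = ((2 * Real.pi * t : ℝ) : ℂ) * Complex.I := by
    push_cast; ring
  rw [e, this, Complex.norm_exp_ofReal_mul_I]

lemma conj_e (t : ℝ) : conj (e t) = e (-t) := by
  rw [e, e, ← Complex.exp_conj]
  simp only [map_mul, Complex.conj_ofReal, Complex.conj_I, map_ofNat, Complex.ofReal_neg]
  ring_nf

lemma e_mul_conj_e (s t : ℝ) : e s * conj (e t) = e (s - t) := by
  rw [conj_e, e, e, e, ← Complex.exp_add]
  congr 1
  push_cast
  ring

lemma continuous_e : Continuous e := by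
  unfold e
  fun_prop

lemma hasDerivAt_e_comp {φ : ℝ → ℝ} {φ' x : ℝ} (h : HasDerivAt φ φ' x) :
    HasDerivAt (fun y => e (φ y)) (e (φ x) * (2 * Real.pi * Complex.I * φ')) x :=
  (h.ofReal_comp.const_mul (2 * Real.pi * Complex.I : ℂ)).cexp

/-- First derivative test for oscillatory integrals with monotone phase derivative. -/
lemma norm_integral_e_le {φ φ' φ'' : ℝ → ℝ} {a b c : ℝ} (hab : a ≤ b) (hc : 0 < c)
    (hφ : ∀ x, HasDerivAt φ (φ' x) x) (hφ' : ∀ x, HasDerivAt φ' (φ'' x) x)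
    (hcont : Continuous φ'')
    (hsign : (∀ x ∈ Set.Icc a b, 0 ≤ φ'' x) ∨ ∀ x ∈ Set.Icc a b, φ'' x ≤ 0)
    (hlow : ∀ x ∈ Set.Icc a b, c ≤ |φ' x|) :
    ‖∫ x in a..b, e (φ x)‖ ≤ 1 / c := by
  have hne : ∀ x ∈ Set.Icc a b, φ' x ≠ 0 := fun x hx h0 => by
    have := hlow x hx
    rw [h0, abs_zero] at this
    linarith
  have hinv : ∀ x ∈ Set.Icc a b, |(φ' x)⁻¹| ≤ c⁻¹ := fun x hx => by
    rw [abs_inv]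
    exact inv_anti₀ hc (hlow x hx)
  have cφ : Continuous φ := continuous_iff_continuousAt.2 fun x => (hφ x).continuousAt
  have cφ' : Continuous φ' := continuous_iff_continuousAt.2 fun x => (hφ' x).continuousAt
  have hI : Set.uIcc a b = Set.Icc a b := Set.uIcc_of_le hab
  have dinv : ∀ x ∈ Set.uIcc a b, HasDerivAt (fun y => (φ' y)⁻¹) (-φ'' x / φ' x ^ 2) x :=
    fun x hx => (hφ' x).inv (hne x (hI ▸ hx))
  have cinv : ContinuousOn (fun x => -φ'' x / φ' x ^ 2) (Set.uIcc a b) := by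
    rw [hI]
    exact hcont.neg.continuousOn.div (cφ'.pow 2).continuousOn fun x hx => pow_ne_zero 2 (hne x hx)
  have iinv : IntervalIntegrable (fun x => -φ'' x / φ' x ^ 2) volume a b :=
    cinv.intervalIntegrable
  have ce : Continuous fun x => e (φ x) * (2 * Real.pi * Complex.I * φ' x) := by
    have := continuous_e.comp cφ
    fun_prop
  have parts := intervalIntegral.integral_mul_deriv_eq_deriv_mul
    (u := fun x => (((φ' x)⁻¹ : ℝ) : ℂ)) (v := fun x => e (φ x))
    (fun x hx => (dinv x hx).ofReal_comp) (fun x _ => hasDerivAt_e_comp (hφ x))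
    (Complex.continuous_ofReal.comp_continuousOn cinv).intervalIntegrable (ce.intervalIntegrable a b)
  have hleft : (∫ x in a..b, (((φ' x)⁻¹ : ℝ) : ℂ) * (e (φ x) * (2 * Real.pi * Complex.I * φ' x)))
      = (2 * Real.pi * Complex.I) * ∫ x in a..b, e (φ x) := by
    rw [← intervalIntegral.integral_const_mul]
    refine intervalIntegral.integral_congr fun x hx => ?_
    have : (φ' x : ℂ) ≠ 0 := by exact_mod_cast hne x (hI ▸ hx)
    simp only [Complex.ofReal_inv]
    field_simp
  rw [hleft] at parts
  have hftc : ∫ x in a..b, -φ'' x / φ' x ^ 2 = (φ' b)⁻¹ - (φ' a)⁻¹ :=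
    intervalIntegral.integral_eq_sub_of_hasDerivAt dinv iinv
  have ha := hinv a ⟨le_rfl, hab⟩
  have hb := hinv b ⟨hab, le_rfl⟩
  have habs : ∫ x in a..b, |(-φ'' x / φ' x ^ 2)| ≤ 2 * c⁻¹ := by
    rw [abs_le] at ha hb
    rcases hsign with h | h
    · have : ∫ x in a..b, |(-φ'' x / φ' x ^ 2)| = ∫ x in a..b, -(-φ'' x / φ' x ^ 2) := by
        refine intervalIntegral.integral_congr fun x hx => abs_of_nonpos ?_
        exact div_nonpos_of_nonpos_of_nonneg (neg_nonpos.2 (h x (hI ▸ hx))) (sq_nonneg _)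
      rw [this, intervalIntegral.integral_neg, hftc]
      linarith
    · have : ∫ x in a..b, |(-φ'' x / φ' x ^ 2)| = ∫ x in a..b, (-φ'' x / φ' x ^ 2) := by
        refine intervalIntegral.integral_congr fun x hx => abs_of_nonneg ?_
        exact div_nonneg (neg_nonneg.2 (h x (hI ▸ hx))) (sq_nonneg _)
      rw [this, hftc]
      linarith
  have hrest : ‖∫ x in a..b, ((-φ'' x / φ' x ^ 2 : ℝ) : ℂ) * e (φ x)‖ ≤ 2 * c⁻¹ := by
    refine (intervalIntegral.norm_integral_le_integral_norm hab).trans ?_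
    simpa only [norm_mul, norm_e, mul_one, Complex.norm_real, Real.norm_eq_abs] using habs
  have key : 2 * Real.pi * ‖∫ x in a..b, e (φ x)‖ ≤ 4 * c⁻¹ := by
    have : ‖(2 * Real.pi * Complex.I : ℂ) * ∫ x in a..b, e (φ x)‖
        = 2 * Real.pi * ‖∫ x in a..b, e (φ x)‖ := by
      simp [abs_of_pos Real.pi_pos]
    rw [← this, parts]
    refine (norm_sub_le _ _).trans ?_
    have h1 := norm_sub_le ((((φ' b)⁻¹ : ℝ) : ℂ) * e (φ b)) ((((φ' a)⁻¹ : ℝ) : ℂ) * e (φ a))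
    simp only [norm_mul, norm_e, mul_one, Complex.norm_real, Real.norm_eq_abs] at h1
    linarith
  rw [one_div]
  nlinarith [Real.pi_gt_three, norm_nonneg (∫ x in a..b, e (φ x)), inv_pos.2 hc]

/-- A set version of the first derivative test for the phase `h (x - s x ^ (p + 1))`. -/
lemma norm_setIntegral_e_le {S : Set ℝ} (hS : S ⊆ Set.Icc 0 1) (hcl : IsClosed S)
    (hoc : S.OrdConnected) {p : ℕ} {h s ε : ℝ} (hh : h ≠ 0) (hε : 0 < ε)
    (hlow : ∀ x ∈ S, ε ≤ |1 - s * (p + 1) * x ^ p|) :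
    ‖∫ x in S, e (h * (x - s * x ^ (p + 1)))‖ ≤ 1 / (ε * |h|) := by
  have hpos : 0 < ε * |h| := mul_pos hε (abs_pos.2 hh)
  rcases S.eq_empty_or_nonempty with rfl | hne
  · simpa only [Measure.restrict_empty, integral_zero_measure, norm_zero] using
      (one_div_pos.2 hpos).le
  have hcomp : IsCompact S := isCompact_Icc.of_isClosed_subset hcl hS
  have hSeq := eq_Icc_of_connected_compact ⟨hne, hoc.isPreconnected⟩ hcomp
  set a := sInf S
  set b := sSup S
  have hab : a ≤ b := by
    rw [hSeq] at hne
    exact Set.nonempty_Icc.1 hne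
  rw [hSeq, integral_Icc_eq_integral_Ioc, ← intervalIntegral.integral_of_le hab]
  have hx0 : ∀ x ∈ Set.Icc a b, 0 ≤ x := fun x hx => (hS (hSeq ▸ hx)).1
  refine norm_integral_e_le (φ' := fun x => h * (1 - s * ((p + 1) * x ^ p)))
    (φ'' := fun x => -(h * s) * ((p + 1) * (p * x ^ (p - 1)))) hab hpos ?_ ?_ (by fun_prop) ?_ ?_
  · intro x
    have := (((hasDerivAt_id x).sub ((hasDerivAt_pow (p + 1) x).const_mul s)).const_mul h)
    simpa using this
  · intro x
    have := ((((hasDerivAt_pow p x).const_mul ((p : ℝ) + 1)).const_mul s).const_sub 1).const_mul h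
    exact this.congr_deriv (by ring)
  · rcases le_total (h * s) 0 with hs | hs
    · left
      intro x hx
      have := hx0 x hx
      have := neg_nonneg.2 hs
      positivity
    · right
      intro x hx
      have := hx0 x hx
      have h2 : (0 : ℝ) ≤ (p + 1) * (p * x ^ (p - 1)) := by positivity
      nlinarith [mul_nonneg hs h2]
  · intro x hx
    rw [abs_mul, mul_comm ε, ← mul_assoc]
    exact mul_le_mul_of_nonneg_left (hlow x (hSeq ▸ hx)) (abs_nonneg _)

/-- Schur's test for the Gram matrix of a finite family of functions. -/
lemma integral_norm_sum_sq_le {α ι : Type*} [MeasurableSpace α] {μ : Measure α}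
    (s : Finset ι) (f : ι → α → ℂ) (a : ι → ℂ) (B : ℝ)
    (hf : ∀ n m, Integrable (fun x => f n x * conj (f m x)) μ)
    (hB : ∀ n ∈ s, ∑ m ∈ s, ‖∫ x, f n x * conj (f m x) ∂μ‖ ≤ B) :
    ∫ x, ‖∑ n ∈ s, a n * f n x‖ ^ 2 ∂μ ≤ B * ∑ n ∈ s, ‖a n‖ ^ 2 := by
  set K : ι → ι → ℂ := fun n m => ∫ x, f n x * conj (f m x) ∂μ with hK
  have hsymm : ∀ n m, ‖K n m‖ = ‖K m n‖ := fun n m => by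
    rw [← Complex.norm_conj (K n m), hK]
    simp only
    rw [← integral_conj]
    simp [mul_comm]
  have hexp : ((∫ x, ‖∑ n ∈ s, a n * f n x‖ ^ 2 ∂μ : ℝ) : ℂ)
      = ∑ n ∈ s, ∑ m ∈ s, a n * conj (a m) * K n m := by
    rw [← integral_complex_ofReal]
    have : ∀ x, ((‖∑ n ∈ s, a n * f n x‖ ^ 2 : ℝ) : ℂ)
        = ∑ n ∈ s, ∑ m ∈ s, a n * conj (a m) * (f n x * conj (f m x)) := fun x => by
      rw [Complex.ofReal_pow, ← Complex.mul_conj', map_sum, Finset.sum_mul_sum]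
      refine Finset.sum_congr rfl fun n _ => Finset.sum_congr rfl fun m _ => ?_
      rw [map_mul]
      ring
    simp_rw [this]
    rw [integral_finsetSum _ fun n _ => integrable_finsetSum _ fun m _ => (hf n m).const_mul _]
    refine Finset.sum_congr rfl fun n _ => ?_
    rw [integral_finsetSum _ fun m _ => (hf n m).const_mul _]
    exact Finset.sum_congr rfl fun m _ => integral_const_mul _ _
  have hnorm : ∫ x, ‖∑ n ∈ s, a n * f n x‖ ^ 2 ∂μ
      ≤ ∑ n ∈ s, ∑ m ∈ s, ‖a n‖ * ‖a m‖ * ‖K n m‖ := by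
    refine (le_abs_self _).trans ?_
    rw [← Real.norm_eq_abs, ← Complex.norm_real, hexp]
    refine (norm_sum_le _ _).trans (Finset.sum_le_sum fun n _ => (norm_sum_le _ _).trans ?_)
    simp
  have hswap : ∑ n ∈ s, ∑ m ∈ s, ‖a m‖ ^ 2 * ‖K n m‖ = ∑ n ∈ s, ∑ m ∈ s, ‖a n‖ ^ 2 * ‖K n m‖ := by
    rw [Finset.sum_comm]
    exact Finset.sum_congr rfl fun n _ => Finset.sum_congr rfl fun m _ => by rw [hsymm]
  calc _ ≤ ∑ n ∈ s, ∑ m ∈ s, ‖a n‖ * ‖a m‖ * ‖K n m‖ := hnorm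
    _ ≤ ∑ n ∈ s, ∑ m ∈ s, (‖a n‖ ^ 2 * ‖K n m‖ + ‖a m‖ ^ 2 * ‖K n m‖) / 2 := by
      refine Finset.sum_le_sum fun n _ => Finset.sum_le_sum fun m _ => ?_
      nlinarith [norm_nonneg (K n m), mul_nonneg (sq_nonneg (‖a n‖ - ‖a m‖)) (norm_nonneg (K n m))]
    _ = ∑ n ∈ s, ∑ m ∈ s, ‖a n‖ ^ 2 * ‖K n m‖ := by
      simp_rw [add_div, Finset.sum_add_distrib, ← Finset.sum_div]
      rw [hswap, add_halves]
    _ ≤ ∑ n ∈ s, ‖a n‖ ^ 2 * B := by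
      refine Finset.sum_le_sum fun n hn => ?_
      rw [← Finset.mul_sum]
      exact mul_le_mul_of_nonneg_left (hB n hn) (sq_nonneg _)
    _ = B * ∑ n ∈ s, ‖a n‖ ^ 2 := by rw [← Finset.sum_mul, mul_comm]

lemma sum_inv_abs_eq_harmonic (M : ℕ) :
    ∑ j ∈ Finset.Icc (-(M : ℤ)) M, |(j : ℝ)|⁻¹ = 2 * (harmonic M : ℝ) := by
  induction M with
  | zero => simp
  | succ M ih =>
    have hset : Finset.Icc (-((M + 1 : ℕ) : ℤ)) ((M + 1 : ℕ) : ℤ)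
        = insert (-((M : ℤ) + 1)) (insert ((M : ℤ) + 1) (Finset.Icc (-(M : ℤ)) M)) := by
      ext x
      simp only [Finset.mem_Icc, Finset.mem_insert]
      omega
    rw [hset, Finset.sum_insert, Finset.sum_insert, ih, harmonic_succ]
    · have : |(M : ℝ) + 1| = M + 1 := abs_of_pos (by positivity)
      push_cast
      rw [abs_neg, this]
      ring
    · simp
    · simp only [Finset.mem_Icc, Finset.mem_insert]
      omega

lemma sum_inv_abs_sub_le {N : ℕ} (hN : 2 ≤ N) {n : ℤ} (hn : n ∈ Finset.Icc (-(N : ℤ)) N) :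
    ∑ m ∈ Finset.Icc (-(N : ℤ)) N, |(n : ℝ) - m|⁻¹ ≤ 8 * Real.log N := by
  have hsub : ∑ m ∈ Finset.Icc (-(N : ℤ)) N, |(n : ℝ) - m|⁻¹
      ≤ ∑ j ∈ Finset.Icc (-((2 * N : ℕ) : ℤ)) ((2 * N : ℕ) : ℤ), |(j : ℝ)|⁻¹ := by
    have himg : ∑ m ∈ Finset.Icc (-(N : ℤ)) N, |(n : ℝ) - m|⁻¹
        = ∑ j ∈ (Finset.Icc (-(N : ℤ)) N).image (fun m => n - m), |(j : ℝ)|⁻¹ := by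
      rw [Finset.sum_image fun x _ y _ hxy => by simpa using hxy]
      simp
    rw [himg]
    refine Finset.sum_le_sum_of_subset_of_nonneg (fun j hj => ?_) fun _ _ _ => by positivity
    simp only [Finset.mem_image, Finset.mem_Icc] at hj hn ⊢
    obtain ⟨m, hm, rfl⟩ := hj
    push_cast
    omega
  have hN' : (2 : ℝ) ≤ N := by exact_mod_cast hN
  have hlog2 : Real.log 2 ≤ Real.log N := Real.log_le_log (by norm_num) hN'
  have hharm := harmonic_le_one_add_log (2 * N)
  push_cast at hharm
  rw [Real.log_mul (by norm_num) (by positivity)] at hharm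
  rw [sum_inv_abs_eq_harmonic] at hsub
  linarith [Real.log_two_gt_d9]

/-- The phase `n x - n² x ^ (p + 1)`. -/
noncomputable def phase (p : ℕ) (n : ℤ) (x : ℝ) : ℝ := n * x - (n : ℝ) ^ 2 * x ^ (p + 1)

/-- The mixed second derivative `∂ₙ∂ₓ` of `phase p n x`. -/
noncomputable def mixedDeriv (p : ℕ) (n : ℤ) (x : ℝ) : ℝ := 1 - 2 * n * (p + 1) * x ^ p

lemma continuous_phase (p : ℕ) (n : ℤ) : Continuous (phase p n) := by
  unfold phase
  fun_prop

lemma continuous_mixedDeriv (p : ℕ) (n : ℤ) : Continuous (mixedDeriv p n) := by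
  unfold mixedDeriv
  fun_prop

lemma phase_sub_phase (p : ℕ) (n m : ℤ) (x : ℝ) :
    phase p n x - phase p m x = ((n : ℝ) - m) * (x - ((n : ℝ) + m) * x ^ (p + 1)) := by
  unfold phase
  ring

/-- `mixedDeriv p n` is monotone or antitone on `[0, ∞)`. -/
lemma mixedDeriv_between {p : ℕ} (n : ℤ) {x y z : ℝ} (hx : 0 ≤ x) (hxy : x ≤ y) (hyz : y ≤ z) :
    min (mixedDeriv p n x) (mixedDeriv p n z) ≤ mixedDeriv p n y ∧
      mixedDeriv p n y ≤ max (mixedDeriv p n x) (mixedDeriv p n z) := by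
  have h1 : x ^ p ≤ y ^ p := pow_le_pow_left₀ hx hxy p
  have h2 : y ^ p ≤ z ^ p := pow_le_pow_left₀ (hx.trans hxy) hyz p
  unfold mixedDeriv
  rcases le_total 0 (2 * (n : ℝ) * (p + 1)) with h | h
  · exact ⟨min_le_of_right_le (by nlinarith), le_max_of_le_left (by nlinarith)⟩
  · exact ⟨min_le_of_left_le (by nlinarith), le_max_of_le_right (by nlinarith)⟩

lemma measurable_indicator_e_phase (p : ℕ) (n : ℤ) {E : Set ℝ} (hE : MeasurableSet E) :
    Measurable (E.indicator fun x => e (phase p n x)) :=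
  (continuous_e.comp (continuous_phase p n)).measurable.indicator hE

lemma norm_indicator_e_phase_le (p : ℕ) (n : ℤ) (E : Set ℝ) (x : ℝ) :
    ‖E.indicator (fun x => e (phase p n x)) x‖ ≤ 1 :=
  (norm_indicator_le_norm_self _ _).trans (norm_e _).le

lemma integrable_norm_sum_indicator_sq (p : ℕ) (s : Finset ℤ) (a : ℤ → ℂ) {E : ℤ → Set ℝ}
    (hE : ∀ n, MeasurableSet (E n)) :
    IntegrableOn (fun x => ‖∑ n ∈ s, a n * (E n).indicator (fun x => e (phase p n x)) x‖ ^ 2)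
      (Set.Icc 0 1) := by
  refine Integrable.of_bound (C := (∑ n ∈ s, ‖a n‖) ^ 2) ?_ (ae_of_all _ fun x => ?_)
  · exact ((Finset.measurable_fun_sum s fun n _ =>
      (measurable_indicator_e_phase p n (hE n)).const_mul (a n)).norm.pow_const 2).aestronglyMeasurable
  · rw [Real.norm_eq_abs, abs_of_nonneg (sq_nonneg _)]
    refine pow_le_pow_left₀ (norm_nonneg _) ((norm_sum_le _ _).trans ?_) 2
    refine Finset.sum_le_sum fun n _ => ?_
    rw [norm_mul]
    exact mul_le_of_le_one_right (norm_nonneg _) (norm_indicator_e_phase_le p n _ x)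

/-- Schur's test for exponential sums with frequency dependent sharp cutoffs. -/
lemma integral_norm_sum_indicator_sq_le (p : ℕ) (s : Finset ℤ) (a : ℤ → ℂ) {E : ℤ → Set ℝ}
    (hE : ∀ n, MeasurableSet (E n)) (hE1 : ∀ n, E n ⊆ Set.Icc 0 1) {B : ℝ}
    (hB : ∀ n ∈ s, ∑ m ∈ s,
      ‖∫ x in E n ∩ E m, e (((n : ℝ) - m) * (x - ((n : ℝ) + m) * x ^ (p + 1)))‖ ≤ B) :
    ∫ x in Set.Icc 0 1, ‖∑ n ∈ s, a n * (E n).indicator (fun x => e (phase p n x)) x‖ ^ 2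
      ≤ B * ∑ n ∈ s, ‖a n‖ ^ 2 := by
  have hmul : ∀ n m : ℤ, (fun x => (E n).indicator (fun x => e (phase p n x)) x *
      conj ((E m).indicator (fun x => e (phase p m x)) x))
      = (E n ∩ E m).indicator
        fun x => e (((n : ℝ) - m) * (x - ((n : ℝ) + m) * x ^ (p + 1))) := fun n m => by
    ext x
    by_cases h1 : x ∈ E n <;> by_cases h2 : x ∈ E m <;>
      simp [h1, h2, e_mul_conj_e, phase_sub_phase]
  refine integral_norm_sum_sq_le s (fun n => (E n).indicator fun x => e (phase p n x)) a B
    (fun n m => ?_) fun n hn => ?_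
  · refine Integrable.of_bound (C := 1) ?_ (ae_of_all _ fun x => ?_)
    · exact ((measurable_indicator_e_phase p n (hE n)).mul
        (Complex.continuous_conj.measurable.comp
          (measurable_indicator_e_phase p m (hE m)))).aestronglyMeasurable
    · rw [norm_mul, Complex.norm_conj]
      exact mul_le_one₀ (norm_indicator_e_phase_le p n _ x) (norm_nonneg _)
        (norm_indicator_e_phase_le p m _ x)
  · refine le_of_eq_of_le (Finset.sum_congr rfl fun m _ => ?_) (hB n hn)
    have hsub : Set.Icc (0 : ℝ) 1 ∩ (E n ∩ E m) = E n ∩ E m :=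
      Set.inter_eq_right.2 (Set.inter_subset_left.trans (hE1 n))
    rw [hmul, setIntegral_indicator ((hE n).inter (hE m)), hsub]

/-- Row sum bound on a region where the mixed derivative is bounded away from zero. -/
lemma sum_norm_setIntegral_le {N : ℕ} (hN : 2 ≤ N) (p : ℕ) {ε : ℝ} (hε : 0 < ε) {E : ℤ → Set ℝ}
    (hcl : ∀ n, IsClosed (E n)) (hE1 : ∀ n, E n ⊆ Set.Icc 0 1) (hoc : ∀ n, (E n).OrdConnected)
    (hlow : ∀ n m, ∀ x ∈ E n ∩ E m, ε ≤ |1 - ((n : ℝ) + m) * (p + 1) * x ^ p|)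
    {n : ℤ} (hn : n ∈ Finset.Icc (-(N : ℤ)) N) :
    ∑ m ∈ Finset.Icc (-(N : ℤ)) N,
      ‖∫ x in E n ∩ E m, e (((n : ℝ) - m) * (x - ((n : ℝ) + m) * x ^ (p + 1)))‖
      ≤ 1 + 1 / ε * (8 * Real.log N) := by
  have hterm : ∀ m : ℤ,
      ‖∫ x in E n ∩ E m, e (((n : ℝ) - m) * (x - ((n : ℝ) + m) * x ^ (p + 1)))‖
      ≤ (if m = n then 1 else 0) + 1 / ε * |(n : ℝ) - m|⁻¹ := fun m => by
    have hsub : E n ∩ E m ⊆ Set.Icc 0 1 := Set.inter_subset_left.trans (hE1 n)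
    split_ifs with h
    · subst h
      rw [sub_self, abs_zero, inv_zero, mul_zero, add_zero]
      have hfin : volume (E m ∩ E m) < ⊤ := (measure_mono hsub).trans_lt (by simp)
      refine (norm_setIntegral_le_of_norm_le_const hfin fun x _ => (norm_e _).le).trans ?_
      rw [one_mul]
      refine (measureReal_mono hsub (by simp)).trans ?_
      simp
    · have hne : (n : ℝ) - m ≠ 0 := sub_ne_zero.2 fun hc => h (by exact_mod_cast hc.symm)
      have := norm_setIntegral_e_le hsub ((hcl n).inter (hcl m))
        ((hoc n).inter (hoc m)) hne hε (hlow n m)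
      rwa [zero_add, one_div, ← mul_inv, ← one_div]
  refine (Finset.sum_le_sum fun m _ => hterm m).trans ?_
  rw [Finset.sum_add_distrib, ← Finset.mul_sum, Finset.sum_ite_eq' _ n, if_pos hn]
  have := sum_inv_abs_sub_le hN hn
  gcongr

lemma dist_le_of_abs_mixedDeriv_lt {p : ℕ} (hp : 1 ≤ p) {n : ℤ} (hn : 1 ≤ n) {ε x y : ℝ}
    (hε' : ε ≤ 1 / 2) (hx : 0 ≤ x) (hxy : x ≤ y)
    (hwx : |mixedDeriv p n x| < ε) (hwy : |mixedDeriv p n y| < ε) :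
    y - x ≤ 4 * ε * (n : ℝ) ^ (-(1 / (p : ℝ))) := by
  have hn' : (1 : ℝ) ≤ n := by exact_mod_cast hn
  have hp' : (1 : ℝ) ≤ p := by exact_mod_cast hp
  have hε : 0 < ε := (abs_nonneg _).trans_lt hwx
  have hy : 0 ≤ y := hx.trans hxy
  rw [mixedDeriv, abs_lt] at hwx hwy
  set c : ℝ := 2 * n * (p + 1) with hc
  have hcn : 4 * (n : ℝ) ≤ c := by rw [hc]; nlinarith
  have hconv : (y - x) * y ^ p ≤ y * (y ^ p - x ^ p) := by
    obtain ⟨q, rfl⟩ := Nat.exists_eq_add_of_le' hp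
    have := pow_le_pow_left₀ hx hxy q
    have := mul_nonneg (mul_nonneg hx hy) (sub_nonneg.2 this)
    rw [pow_succ, pow_succ]
    nlinarith
  have h4 : y - x ≤ 4 * ε * y := by
    have h1 : c * ((y - x) * y ^ p) ≤ c * (y * (y ^ p - x ^ p)) :=
      mul_le_mul_of_nonneg_left hconv (by linarith)
    have h2 : (y - x) * (1 / 2) ≤ (y - x) * (c * y ^ p) :=
      mul_le_mul_of_nonneg_left (by linarith) (by linarith)
    have h3 : y * (c * y ^ p - c * x ^ p) ≤ y * (2 * ε) :=
      mul_le_mul_of_nonneg_left (by linarith) hy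
    nlinarith
  have hyn : y ≤ (n : ℝ) ^ (-(1 / (p : ℝ))) := by
    have hyp : y ^ p ≤ (n : ℝ)⁻¹ := by
      have h5 := mul_le_mul_of_nonneg_right hcn (pow_nonneg hy p)
      rw [← one_div, le_div_iff₀ (by linarith)]
      linarith
    calc y = (y ^ p) ^ (1 / (p : ℝ)) := by
          rw [one_div, Real.pow_rpow_inv_natCast hy (by omega)]
      _ ≤ ((n : ℝ)⁻¹) ^ (1 / (p : ℝ)) := Real.rpow_le_rpow (by positivity) hyp (by positivity)
      _ = _ := by rw [Real.rpow_neg (by linarith), Real.inv_rpow (by linarith)]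
  exact h4.trans (mul_le_mul_of_nonneg_left hyn (by positivity))

/-- Row sum bound on the region where the mixed derivative is small. -/
lemma sum_norm_setIntegral_le_of_small {N : ℕ} {p : ℕ} (hp : 1 ≤ p) {ε : ℝ}
    (hε : 0 < ε) (hε' : ε ≤ 1 / 2) {E : ℤ → Set ℝ}
    (hE : ∀ n x, x ∈ E n ↔ x ∈ Set.Icc 0 1 ∧ |mixedDeriv p n x| < ε)
    {n : ℤ} (hn : n ∈ Finset.Icc (-(N : ℤ)) N) :
    ∑ m ∈ Finset.Icc (-(N : ℤ)) N,
      ‖∫ x in E n ∩ E m, e (((n : ℝ) - m) * (x - ((n : ℝ) + m) * x ^ (p + 1)))‖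
      ≤ 32 * ε ^ 2 * (N : ℝ) ^ (1 - 1 / (p : ℝ)) + 2 := by
  rcases le_or_gt n 0 with hn0 | hn0
  · have hempty : E n = ∅ := by
      refine Set.eq_empty_of_forall_notMem fun x hx => ?_
      obtain ⟨⟨hx0, -⟩, hw⟩ := (hE n x).1 hx
      have h1 : (n : ℝ) ≤ 0 := by exact_mod_cast hn0
      have h2 : (0 : ℝ) ≤ (p + 1) * x ^ p := by positivity
      rw [mixedDeriv, abs_lt] at hw
      nlinarith [mul_nonneg (neg_nonneg.2 h1) h2]
    simp only [hempty, Set.empty_inter, Measure.restrict_empty, integral_zero_measure, norm_zero,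
      Finset.sum_const_zero]
    positivity
  have hn1 : (1 : ℝ) ≤ n := by exact_mod_cast hn0
  have hnN : (n : ℝ) ≤ N := by exact_mod_cast (Finset.mem_Icc.1 hn).2
  have hp' : (1 : ℝ) ≤ p := by exact_mod_cast hp
  set D : ℝ := (n : ℝ) ^ (-(1 / (p : ℝ))) with hD
  have hD0 : 0 < D := Real.rpow_pos_of_pos (by linarith) _
  have hD1 : D ≤ 1 := Real.rpow_le_one_of_one_le_of_nonpos hn1 (by simp)
  have hvol : volume (E n) ≤ ENNReal.ofReal (4 * ε * D) := by
    refine (Real.volume_le_diam _).trans (Metric.ediam_le fun x hx y hy => ?_)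
    obtain ⟨⟨hx0, -⟩, hwx⟩ := (hE n x).1 hx
    obtain ⟨⟨hy0, -⟩, hwy⟩ := (hE n y).1 hy
    rw [edist_dist, Real.dist_eq]
    refine ENNReal.ofReal_le_ofReal ?_
    rcases le_total x y with hxy | hxy
    · rw [abs_sub_comm, abs_of_nonneg (sub_nonneg.2 hxy)]
      exact dist_le_of_abs_mixedDeriv_lt hp hn0 hε' hx0 hxy hwx hwy
    · rw [abs_of_nonneg (sub_nonneg.2 hxy)]
      exact dist_le_of_abs_mixedDeriv_lt hp hn0 hε' hy0 hxy hwy hwx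
  set R : ℤ := ⌊4 * ε * n⌋ with hR
  have hterm : ∀ m : ℤ,
      ‖∫ x in E n ∩ E m, e (((n : ℝ) - m) * (x - ((n : ℝ) + m) * x ^ (p + 1)))‖
      ≤ if m ∈ Finset.Icc (n - R) (n + R) then 4 * ε * D else 0 := fun m => by
    split_ifs with h
    · have hle : volume (E n ∩ E m) ≤ ENNReal.ofReal (4 * ε * D) :=
        (measure_mono Set.inter_subset_left).trans hvol
      refine (norm_setIntegral_le_of_norm_le_const (hle.trans_lt ENNReal.ofReal_lt_top)
        fun x _ => (norm_e _).le).trans ?_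
      rw [one_mul]
      exact ENNReal.toReal_le_of_le_ofReal (by positivity) hle
    · have hempty : E n ∩ E m = ∅ := by
        refine Set.eq_empty_of_forall_notMem fun x hx => h ?_
        obtain ⟨⟨hx0, -⟩, hw⟩ := (hE n x).1 hx.1
        obtain ⟨-, hw'⟩ := (hE m x).1 hx.2
        rw [mixedDeriv, abs_lt] at hw hw'
        set c : ℝ := 2 * (p + 1) * x ^ p
        have e1 : 2 * (n : ℝ) * (p + 1) * x ^ p = n * c := by simp only [c]; ring
        have e2 : 2 * (m : ℝ) * (p + 1) * x ^ p = m * c := by simp only [c]; ring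
        rw [e1] at hw
        rw [e2] at hw'
        have hc : 0 < c := by
          by_contra hcon
          nlinarith
        have hd1 : (n : ℝ) - m ≤ 4 * ε * n := by
          refine le_of_mul_le_mul_right ?_ hc
          nlinarith
        have hd2 : (m : ℝ) - n ≤ 4 * ε * n := by
          refine le_of_mul_le_mul_right ?_ hc
          nlinarith
        have i1 : n - m ≤ R := Int.le_floor.2 (by push_cast; exact hd1)
        have i2 : m - n ≤ R := Int.le_floor.2 (by push_cast; exact hd2)
        rw [Finset.mem_Icc]
        omega
      rw [hempty]
      simp
  have hR0 : 0 ≤ R := Int.floor_nonneg.2 (by positivity)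
  have hRle : (R : ℝ) ≤ 4 * ε * n := Int.floor_le _
  have hcard : ((Finset.Icc (n - R) (n + R)).card : ℝ) ≤ 8 * ε * n + 1 := by
    have : ((Finset.Icc (n - R) (n + R)).card : ℤ) = 2 * R + 1 := by
      rw [Int.card_Icc]
      omega
    have : ((Finset.Icc (n - R) (n + R)).card : ℝ) = 2 * R + 1 := by exact_mod_cast this
    linarith
  have hnD : n * D ≤ (N : ℝ) ^ (1 - 1 / (p : ℝ)) := by
    have : n * D = (n : ℝ) ^ (1 - 1 / (p : ℝ)) := by
      rw [sub_eq_add_neg, Real.rpow_add (by linarith), Real.rpow_one]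
    rw [this]
    refine Real.rpow_le_rpow (by linarith) hnN (sub_nonneg.2 ?_)
    rw [div_le_one (by linarith)]
    exact hp'
  calc _ ≤ ∑ m ∈ Finset.Icc (-(N : ℤ)) N,
        if m ∈ Finset.Icc (n - R) (n + R) then 4 * ε * D else 0 :=
        Finset.sum_le_sum fun m _ => hterm m
    _ ≤ (Finset.Icc (n - R) (n + R)).card * (4 * ε * D) := by
        rw [← Finset.sum_filter, Finset.sum_const, nsmul_eq_mul]
        refine mul_le_mul_of_nonneg_right ?_ (by positivity)
        exact_mod_cast Finset.card_le_card fun m hm => (Finset.mem_filter.1 hm).2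
    _ ≤ (8 * ε * n + 1) * (4 * ε * D) := mul_le_mul_of_nonneg_right hcard (by positivity)
    _ = 32 * ε ^ 2 * (n * D) + 4 * ε * D := by ring
    _ ≤ _ := by
        have : 4 * ε * D ≤ 2 := by nlinarith
        gcongr

lemma isClosed_setOf_mixedDeriv_mem (p : ℕ) (n : ℤ) {T : Set ℝ} (hT : IsClosed T) :
    IsClosed {x | x ∈ Set.Icc (0 : ℝ) 1 ∧ mixedDeriv p n x ∈ T} :=
  isClosed_Icc.inter (hT.preimage (continuous_mixedDeriv p n))

/-- The `L²(0,1)` bound for the exponential sum with phase `n x - n² x ^ (p + 1)`. -/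
lemma integral_norm_sum_phase_sq_le {p : ℕ} (hp : 1 ≤ p) {N : ℕ} (hN : 2 ≤ N) (a : ℤ → ℂ) :
    ∫ x in Set.Icc (0 : ℝ) 1, ‖∑ n ∈ Finset.Icc (-(N : ℤ)) N, a n * e (phase p n x)‖ ^ 2
      ≤ 168 * (N : ℝ) ^ (((p : ℝ) - 1) / (3 * p)) * Real.log N *
        ∑ n ∈ Finset.Icc (-(N : ℤ)) N, ‖a n‖ ^ 2 := by
  have hN' : (2 : ℝ) ≤ N := by exact_mod_cast hN
  have hN0 : (0 : ℝ) < N := by linarith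
  have hp' : (1 : ℝ) ≤ p := by exact_mod_cast hp
  have hL : 1 ≤ 2 * Real.log N := by
    linarith [Real.log_two_gt_d9, Real.log_le_log (by norm_num) hN']
  set s := Finset.Icc (-(N : ℤ)) N with hs
  set θ : ℝ := ((p : ℝ) - 1) / (3 * p) with hθ
  have hθ0 : 0 ≤ θ := div_nonneg (by linarith) (by linarith)
  set X : ℝ := (N : ℝ) ^ θ with hX
  have hX1 : 1 ≤ X := Real.one_le_rpow (by linarith) hθ0
  set ε : ℝ := 1 / (2 * X) with hεdef
  have hε : 0 < ε := by positivity
  have hε' : ε ≤ 1 / 2 := by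
    rw [hεdef]
    gcongr
    linarith
  have hX3 : (N : ℝ) ^ (1 - 1 / (p : ℝ)) = X ^ 3 := by
    rw [hX, ← Real.rpow_mul_natCast hN0.le]
    congr 1
    rw [hθ]
    push_cast
    field_simp
  set E₁ : ℤ → Set ℝ := fun n => {x | x ∈ Set.Icc (0 : ℝ) 1 ∧ mixedDeriv p n x ∈ Set.Ici ε}
  set E₂ : ℤ → Set ℝ := fun n => {x | x ∈ Set.Icc (0 : ℝ) 1 ∧ mixedDeriv p n x ∈ Set.Iic (-ε)}
  set E₃ : ℤ → Set ℝ := fun n => {x | x ∈ Set.Icc (0 : ℝ) 1 ∧ |mixedDeriv p n x| < ε}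
  have c₁ : ∀ n, IsClosed (E₁ n) := fun n => isClosed_setOf_mixedDeriv_mem p n isClosed_Ici
  have c₂ : ∀ n, IsClosed (E₂ n) := fun n => isClosed_setOf_mixedDeriv_mem p n isClosed_Iic
  have m₃ : ∀ n, MeasurableSet (E₃ n) := fun n => measurableSet_Icc.inter
    (measurableSet_lt (continuous_mixedDeriv p n).abs.measurable measurable_const)
  have avg : ∀ (n m : ℤ) (x : ℝ), 1 - ((n : ℝ) + m) * (p + 1) * x ^ p
      = (mixedDeriv p n x + mixedDeriv p m x) / 2 := fun n m x => by
    unfold mixedDeriv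
    ring
  have b₁ := integral_norm_sum_indicator_sq_le p s a (fun n => (c₁ n).measurableSet)
    (fun n x hx => hx.1) fun n hn => sum_norm_setIntegral_le hN p hε c₁ (fun n x hx => hx.1)
      (fun n => ⟨fun x hx z hz y hy => ⟨⟨hx.1.1.trans hy.1, hy.2.trans hz.1.2⟩,
        (le_min hx.2 hz.2).trans (mixedDeriv_between n hx.1.1 hy.1 hy.2).1⟩⟩)
      (fun n m x hx => by
        rw [avg]
        have h1 : ε ≤ mixedDeriv p n x := hx.1.2
        have h2 : ε ≤ mixedDeriv p m x := hx.2.2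
        exact (by linarith : ε ≤ _).trans (le_abs_self _)) hn
  have b₂ := integral_norm_sum_indicator_sq_le p s a (fun n => (c₂ n).measurableSet)
    (fun n x hx => hx.1) fun n hn => sum_norm_setIntegral_le hN p hε c₂ (fun n x hx => hx.1)
      (fun n => ⟨fun x hx z hz y hy => ⟨⟨hx.1.1.trans hy.1, hy.2.trans hz.1.2⟩,
        (mixedDeriv_between n hx.1.1 hy.1 hy.2).2.trans (max_le hx.2 hz.2)⟩⟩)
      (fun n m x hx => by
        rw [avg]
        have h1 : mixedDeriv p n x ≤ -ε := hx.1.2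
        have h2 : mixedDeriv p m x ≤ -ε := hx.2.2
        exact (by linarith : ε ≤ _).trans (neg_le_abs _)) hn
  have b₃ := integral_norm_sum_indicator_sq_le p s a m₃ (fun n x hx => hx.1)
    fun n hn => sum_norm_setIntegral_le_of_small hp hε hε' (fun n x => Iff.rfl) hn
  have i₁ := integrable_norm_sum_indicator_sq p s a fun n => (c₁ n).measurableSet
  have i₂ := integrable_norm_sum_indicator_sq p s a fun n => (c₂ n).measurableSet
  have i₃ := integrable_norm_sum_indicator_sq p s a m₃
  set F : (ℤ → Set ℝ) → ℝ → ℂ := fun E x =>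
    ∑ n ∈ s, a n * (E n).indicator (fun x => e (phase p n x)) x with hF
  have hsplit : ∀ x ∈ Set.Icc (0 : ℝ) 1,
      ‖∑ n ∈ s, a n * e (phase p n x)‖ ^ 2
        ≤ 3 * (‖F E₁ x‖ ^ 2 + ‖F E₂ x‖ ^ 2 + ‖F E₃ x‖ ^ 2) := fun x hx => by
    have hsum : ∑ n ∈ s, a n * e (phase p n x) = F E₁ x + F E₂ x + F E₃ x := by
      simp only [hF]
      rw [← Finset.sum_add_distrib, ← Finset.sum_add_distrib]
      refine Finset.sum_congr rfl fun n _ => ?_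
      rw [← mul_add, ← mul_add]
      congr 1
      have k₁ : x ∈ E₁ n ↔ ε ≤ mixedDeriv p n x := and_iff_right hx
      have k₂ : x ∈ E₂ n ↔ mixedDeriv p n x ≤ -ε := and_iff_right hx
      have k₃ : x ∈ E₃ n ↔ |mixedDeriv p n x| < ε := and_iff_right hx
      classical
      simp only [Set.indicator_apply, k₁, k₂, k₃, abs_lt]
      rcases lt_or_ge (-ε) (mixedDeriv p n x) with h2 | h2
      · rcases le_or_gt ε (mixedDeriv p n x) with h1 | h1
        · simp [h1, h2, not_le.2 h2, not_lt.2 h1]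
        · simp [h1, h2, not_le.2 h2, not_le.2 h1]
      · have h1 : mixedDeriv p n x < ε := by linarith
        simp [h2, not_lt.2 h2, not_le.2 h1]
    rw [hsum]
    have h3 := norm_add₃_le (a := F E₁ x) (b := F E₂ x) (c := F E₃ x)
    calc _ ≤ (‖F E₁ x‖ + ‖F E₂ x‖ + ‖F E₃ x‖) ^ 2 := pow_le_pow_left₀ (norm_nonneg _) h3 2
      _ ≤ _ := by
        nlinarith [sq_nonneg (‖F E₁ x‖ - ‖F E₂ x‖), sq_nonneg (‖F E₁ x‖ - ‖F E₃ x‖),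
          sq_nonneg (‖F E₂ x‖ - ‖F E₃ x‖)]
  have hcont : Continuous fun x => ‖∑ n ∈ s, a n * e (phase p n x)‖ ^ 2 :=
    (continuous_finsetSum s fun n _ =>
      (continuous_e.comp (continuous_phase p n)).const_mul (a n)).norm.pow 2
  have hint : ∫ x in Set.Icc (0 : ℝ) 1, ‖∑ n ∈ s, a n * e (phase p n x)‖ ^ 2
      ≤ 3 * ((∫ x in Set.Icc (0 : ℝ) 1, ‖F E₁ x‖ ^ 2) + (∫ x in Set.Icc (0 : ℝ) 1, ‖F E₂ x‖ ^ 2)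
        + ∫ x in Set.Icc (0 : ℝ) 1, ‖F E₃ x‖ ^ 2) := by
    have i₁₂ : IntegrableOn (fun x => ‖F E₁ x‖ ^ 2 + ‖F E₂ x‖ ^ 2) (Set.Icc 0 1) := i₁.add i₂
    rw [← integral_add i₁ i₂, ← integral_add i₁₂ i₃, ← integral_const_mul]
    exact setIntegral_mono_on (hcont.continuousOn.integrableOn_Icc)
      ((i₁₂.add i₃).const_mul 3) measurableSet_Icc hsplit
  refine hint.trans ?_
  set S := ∑ n ∈ s, ‖a n‖ ^ 2
  have hS : 0 ≤ S := Finset.sum_nonneg fun n _ => sq_nonneg _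
  have hXL : X ≤ 2 * X * Real.log N := by nlinarith
  have hB : 1 + 1 / ε * (8 * Real.log N) ≤ 18 * X * Real.log N := by
    rw [hεdef, one_div_one_div]
    nlinarith
  have hB' : 32 * ε ^ 2 * (N : ℝ) ^ (1 - 1 / (p : ℝ)) + 2 ≤ 20 * X * Real.log N := by
    have : 32 * ε ^ 2 * (N : ℝ) ^ (1 - 1 / (p : ℝ)) = 8 * X := by
      rw [hX3, hεdef]
      field_simp
      norm_num
    rw [this]
    nlinarith
  have j₁ := b₁.trans (mul_le_mul_of_nonneg_right hB hS)
  have j₂ := b₂.trans (mul_le_mul_of_nonneg_right hB hS)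
  have j₃ := b₃.trans (mul_le_mul_of_nonneg_right hB' hS)
  calc _ ≤ 3 * (18 * X * Real.log N * S + 18 * X * Real.log N * S + 20 * X * Real.log N * S) := by
        gcongr
    _ = _ := by ring

/-- Reflection `x ↦ -x` turns the exponential sum into one of the same kind. -/
lemma exists_norm_sum_phase_neg_eq (p N : ℕ) (a : ℤ → ℂ) :
    ∃ b : ℤ → ℂ, (∑ n ∈ Finset.Icc (-(N : ℤ)) N, ‖b n‖ ^ 2
        = ∑ n ∈ Finset.Icc (-(N : ℤ)) N, ‖a n‖ ^ 2) ∧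
      ∀ x, ‖∑ n ∈ Finset.Icc (-(N : ℤ)) N, a n * e (phase p n (-x))‖
        = ‖∑ n ∈ Finset.Icc (-(N : ℤ)) N, b n * e (phase p n x)‖ := by
  rcases Nat.even_or_odd (p + 1) with hp | hp
  · have hneg : ∀ {M : Type} [AddCommMonoid M] (g : ℤ → M),
        ∑ n ∈ Finset.Icc (-(N : ℤ)) N, g (-n) = ∑ n ∈ Finset.Icc (-(N : ℤ)) N, g n := fun g =>
      Finset.sum_nbij' (fun n => -n) (fun n => -n)
        (fun n hn => by simp only [Finset.mem_Icc] at hn ⊢; omega)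
        (fun n hn => by simp only [Finset.mem_Icc] at hn ⊢; omega)
        (fun n _ => neg_neg n) (fun n _ => neg_neg n) fun n _ => rfl
    refine ⟨fun n => a (-n), hneg fun n => ‖a n‖ ^ 2, fun x => ?_⟩
    rw [← hneg fun n => a n * e (phase p n (-x))]
    simp [phase, hp.neg_pow]
  · refine ⟨fun n => conj (a n), by simp, fun x => ?_⟩
    rw [← Complex.norm_conj, map_sum]
    congr 1
    refine Finset.sum_congr rfl fun n _ => ?_
    rw [map_mul, conj_e]
    congr 2
    unfold phase
    rw [hp.neg_pow]
    ring

/-- **Theorem (upper bound in Theorem 2).** For `k ≥ 3` there are `C > 0` and `A ≥ 0`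
(depending only on `k`) such that for all `N ≥ 2` and all `(a_n)_{n=-N}^N`,
`‖∑_{n=-N}^N a_n e(nx − n²xᵏ)‖_{L²(-1,1)} ≤ C (log N)^A N^{(k−2)/(6(k−1))} (∑ |a_n|²)^{1/2}`. -/
theorem stmt1 (k : ℕ) (hk : 3 ≤ k) :
    ∃ C > 0, ∃ A : ℝ, 0 ≤ A ∧ ∀ N : ℕ, 2 ≤ N → ∀ a : ℤ → ℂ,
      eLpNorm (fun x : ℝ =>
          ∑ n ∈ Finset.Icc (-(N:ℤ)) (N:ℤ), a n * e ((n:ℝ) * x - (n:ℝ)^2 * x^k)) 2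
        (volume.restrict (Set.Ioo (-1) 1))
      ≤ ENNReal.ofReal
          (C * Real.log N ^ A * (N:ℝ) ^ (((k:ℝ) - 2) / (6 * ((k:ℝ) - 1))) *
            Real.sqrt (∑ n ∈ Finset.Icc (-(N:ℤ)) (N:ℤ), ‖a n‖^2)) := by
  obtain ⟨p, rfl⟩ : ∃ p, k = p + 1 := ⟨k - 1, by omega⟩
  have hp : 1 ≤ p := by omega
  refine ⟨√336, by positivity, 1 / 2, by norm_num, fun N hN a => ?_⟩
  have hL : 0 ≤ Real.log N := Real.log_natCast_nonneg N
  set f : ℝ → ℂ := fun x =>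
    ∑ n ∈ Finset.Icc (-(N:ℤ)) (N:ℤ), a n * e ((n:ℝ) * x - (n:ℝ)^2 * x^(p + 1)) with hf
  have hcont : Continuous f := continuous_finsetSum _ fun n _ =>
    (continuous_e.comp (continuous_phase p n)).const_mul (a n)
  have hint : ∀ u v : ℝ, IntervalIntegrable (fun x => ‖f x‖ ^ 2) volume u v := fun u v =>
    (hcont.norm.pow 2).intervalIntegrable u v
  obtain ⟨b, hb, hab⟩ := exists_norm_sum_phase_neg_eq p N a
  have hpos := integral_norm_sum_phase_sq_le hp hN a
  have hneg := integral_norm_sum_phase_sq_le hp hN b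
  rw [hb] at hneg
  simp_rw [← hab] at hneg
  rw [integral_Icc_eq_integral_Ioc, ← intervalIntegral.integral_of_le zero_le_one] at hpos hneg
  have hcomp := intervalIntegral.integral_comp_neg (a := 0) (b := 1) fun x => ‖f x‖ ^ 2
  rw [neg_zero] at hcomp
  set S := ∑ n ∈ Finset.Icc (-(N:ℤ)) (N:ℤ), ‖a n‖^2
  have htotal : ∫ x in Set.Ioo (-1 : ℝ) 1, ‖f x‖ ^ 2
      ≤ 336 * (N : ℝ) ^ (((p : ℝ) - 1) / (3 * p)) * Real.log N * S := by
    rw [← integral_Ioc_eq_integral_Ioo, ← intervalIntegral.integral_of_le (by norm_num),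
      ← intervalIntegral.integral_add_adjacent_intervals (hint (-1) 0) (hint 0 1), ← hcomp]
    refine (add_le_add hneg hpos).trans_eq ?_
    ring
  have hmem : MemLp f 2 (volume.restrict (Set.Ioo (-1) 1)) :=
    (memLp_two_iff_integrable_sq_norm hcont.aestronglyMeasurable).2
      ((hcont.norm.pow 2).continuousOn.integrableOn_Icc.mono_set Set.Ioo_subset_Icc_self)
  rw [hmem.eLpNorm_eq_integral_rpow_norm two_ne_zero ENNReal.ofNat_ne_top]
  refine ENNReal.ofReal_le_ofReal ?_
  simp only [ENNReal.toReal_ofNat, Real.rpow_two]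
  rw [← one_div, ← Real.sqrt_eq_rpow]
  refine (Real.sqrt_le_sqrt htotal).trans_eq ?_
  rw [Real.sqrt_mul (by positivity), Real.sqrt_mul (by positivity), Real.sqrt_mul (by positivity),
    ← Real.sqrt_eq_rpow (Real.log N), Real.sqrt_eq_rpow ((N : ℝ) ^ _), ← Real.rpow_mul (by positivity)]
  have hexp : ((p : ℝ) - 1) / (3 * p) * (1 / 2)
      = (((p + 1 : ℕ) : ℝ) - 2) / (6 * (((p + 1 : ℕ) : ℝ) - 1)) := by
    push_cast
    rw [div_mul_div_comm]
    congr 1 <;> ring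
  rw [hexp]
  ring
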